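/- arXiv:2404.13019 — 6 statements merged into one kernel-verified Lean document; each statement's English description precedes it below -/
import Mathlib

section
/- Let u : [0,∞) → ℝ be a nonnegative locally integrable function, and suppose that for every t > 0 the improper integral f(t) := t ∫₀^∞ u(x) e^{−t x} dx converges. If lim_{t→0⁺} f(t) = 0, then the Cesàro mean σ(x) := (1/x) ∫₀^x u(s) ds tends to 0 as x → +∞. -/
open Filter Set MeasureTheory

theorem intervalIntegrable_of_locallyIntegrableOn_Ici {u : ℝ → ℝ}
    (hloc : LocallyIntegrableOn u (Ici 0)) {a b : ℝ} (ha : 0 ≤ a) (hb : 0 ≤ b) :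
    IntervalIntegrable u volume a b := by
  rw [intervalIntegrable_iff']
  exact hloc.integrableOn_compact_subset
    (fun x hx => (le_inf ha hb).trans hx.1) isCompact_uIcc

/-- Partial Laplace–Abel means of a nonnegative function are bounded by their limit. -/
theorem mul_integral_mul_exp_le_of_tendsto {u : ℝ → ℝ} (hpos : ∀ x, 0 ≤ x → 0 ≤ u x)
    (hloc : LocallyIntegrableOn u (Ici 0)) {t L : ℝ} (ht : 0 < t)
    (hL : Tendsto (fun X : ℝ => t * ∫ x in (0 : ℝ)..X, u x * Real.exp (-(t * x)))
      atTop (nhds L)) {x : ℝ} (hx : 0 ≤ x) :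
    t * ∫ s in (0 : ℝ)..x, u s * Real.exp (-(t * s)) ≤ L := by
  refine ge_of_tendsto hL ?_
  filter_upwards [eventually_ge_atTop x] with X hX
  have hX0 : 0 ≤ X := hx.trans hX
  refine mul_le_mul_of_nonneg_left ?_ ht.le
  refine intervalIntegral.integral_mono_interval le_rfl hx hX ?_ ?_
  · refine (ae_restrict_iff' measurableSet_Ioc).2 (Eventually.of_forall fun s hs => ?_)
    exact mul_nonneg (hpos s hs.1.le) (Real.exp_pos _).le
  · exact (intervalIntegrable_of_locallyIntegrableOn_Ici hloc le_rfl hX0).mul_continuousOn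
      (by fun_prop)

/-- The Cesàro mean at `x` is at most `e` times the Abel–Laplace mean truncated at `x`,
with parameter `1 / x`. -/
theorem cesaro_le_exp_one_mul_truncated_laplace {u : ℝ → ℝ} (hpos : ∀ x, 0 ≤ x → 0 ≤ u x)
    (hloc : LocallyIntegrableOn u (Ici 0)) {x : ℝ} (hx : 0 < x) :
    (1 / x) * ∫ s in (0 : ℝ)..x, u s ≤
      Real.exp 1 * ((1 / x) * ∫ s in (0 : ℝ)..x, u s * Real.exp (-((1 / x) * s))) := by
  have hu := intervalIntegrable_of_locallyIntegrableOn_Ici hloc le_rfl hx.le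
  rw [mul_left_comm, ← intervalIntegral.integral_const_mul (Real.exp 1)]
  refine mul_le_mul_of_nonneg_left ?_ (one_div_nonneg.2 hx.le)
  refine intervalIntegral.integral_mono_on hx.le hu
    ((hu.mul_continuousOn (by fun_prop)).const_mul _) fun s hs => ?_
  have hsx : 1 / x * s ≤ 1 := by
    rw [one_div_mul_eq_div]
    exact (div_le_one hx).2 hs.2
  have hexp : 1 ≤ Real.exp 1 * Real.exp (-(1 / x * s)) := by
    rw [← Real.exp_add]
    exact Real.one_le_exp (by linarith)
  calc u s ≤ u s * (Real.exp 1 * Real.exp (-(1 / x * s))) :=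
        le_mul_of_one_le_right (hpos s hs.1) hexp
    _ = Real.exp 1 * (u s * Real.exp (-(1 / x * s))) := by ring

/-- Tauberian result for Laplace transforms of nonnegative functions: if the
Abel–Laplace means `f(t) = t ∫₀^∞ u(x) e^{-tx} dx` (understood as improper
integrals) tend to `0` as `t → 0⁺`, then the Cesàro means of `u` tend to `0`. -/
theorem cesaro_tendsto_zero_of_laplace_tendsto_zero
    (u : ℝ → ℝ) (f : ℝ → ℝ)
    (hpos : ∀ x, 0 ≤ x → 0 ≤ u x)
    (hloc : LocallyIntegrableOn u (Ici 0))
    (hf : ∀ t : ℝ, 0 < t →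
      Tendsto (fun X : ℝ => t * ∫ x in (0 : ℝ)..X, u x * Real.exp (-(t * x)))
        atTop (nhds (f t)))
    (h0 : Tendsto f (nhdsWithin 0 (Ioi 0)) (nhds 0)) :
    Tendsto (fun x : ℝ => (1 / x) * ∫ s in (0 : ℝ)..x, u s) atTop (nhds 0) := by
  have hinv : Tendsto (fun x : ℝ => 1 / x) atTop (nhdsWithin 0 (Ioi 0)) := by
    simpa only [one_div] using tendsto_inv_atTop_nhdsGT_zero (𝕜 := ℝ)
  have hbound : Tendsto (fun x : ℝ => Real.exp 1 * f (1 / x)) atTop (nhds 0) := by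
    simpa using (h0.comp hinv).const_mul (Real.exp 1)
  refine squeeze_zero' ?_ ?_ hbound
  · filter_upwards [eventually_gt_atTop 0] with x hx
    exact mul_nonneg (one_div_nonneg.2 hx.le)
      (intervalIntegral.integral_nonneg hx.le fun s hs => hpos s hs.1)
  · filter_upwards [eventually_gt_atTop 0] with x hx
    have ht : 0 < 1 / x := by positivity
    exact (cesaro_le_exp_one_mul_truncated_laplace hpos hloc hx).trans
      (mul_le_mul_of_nonneg_left
        (mul_integral_mul_exp_le_of_tendsto hpos hloc ht (hf _ ht) hx.le) (Real.exp_pos 1).le)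
end

section
/- Let u : [0,∞) → ℝ be a locally integrable slowly decreasing function, and suppose its Cesàro mean σ(x) := (1/x) ∫₀^x u(s) ds converges to a finite limit ℓ ∈ ℝ as x → +∞. Then u(x) → ℓ as x → +∞. -/
open Filter Set MeasureTheory

/-- `u : [0,∞) → ℝ` is slowly decreasing at infinity:
`lim_{λ→1⁺} liminf_{x→∞} (u(λx) − u(x)) ≥ 0`, the outer limit being understood
as a lower limit, and values taken in `EReal` so that the lower limits always exist. -/
def SlowlyDecreasing (u : ℝ → ℝ) : Prop :=
  (0 : EReal) ≤
    liminf (fun lam : ℝ =>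
      liminf (fun x : ℝ => ((u (lam * x) - u x : ℝ) : EReal)) atTop)
      (nhdsWithin 1 (Ioi 1))

namespace SlowlyDecreasing

lemma exists_eventually_lt {u : ℝ → ℝ} (hsd : SlowlyDecreasing u) {ε : ℝ} (hε : 0 < ε) :
    ∃ b > 1, ∀ lam ∈ Ioc 1 b, ∀ᶠ x in atTop, u x - u (lam * x) < ε := by
  have hlt : ((-ε : ℝ) : EReal) < 0 := by exact_mod_cast neg_lt_zero.mpr hε
  have h := eventually_lt_of_lt_liminf (hlt.trans_le hsd)
  obtain ⟨b, hb, hsub⟩ := mem_nhdsGT_iff_exists_Ioc_subset.mp h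
  refine ⟨b, hb, fun lam hlam => ?_⟩
  have hlt_liminf : ((-ε : ℝ) : EReal) <
      liminf (fun x : ℝ => ((u (lam * x) - u x : ℝ) : EReal)) atTop := hsub hlam
  filter_upwards [eventually_lt_of_lt_liminf hlt_liminf] with x hx
  have : -ε < u (lam * x) - u x := by exact_mod_cast hx
  linarith

end SlowlyDecreasing

lemma intervalIntegrable_of_locallyIntegrableOn_Ici_s5 {u : ℝ → ℝ}
    (hloc : LocallyIntegrableOn u (Ici 0)) {p q : ℝ} (hp : 0 ≤ p) (hq : 0 ≤ q) :
    IntervalIntegrable u volume p q :=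
  (hloc.integrableOn_compact_subset
    (fun _ hx => (le_min hp hq).trans hx.1) isCompact_uIcc).intervalIntegrable

/-- The average of `u` over `[px, qx]` inherits the limit of the Cesàro mean. -/
lemma tendsto_average_of_cesaro_tendsto {u : ℝ → ℝ} {ℓ : ℝ}
    (hloc : LocallyIntegrableOn u (Ici 0))
    (hσ : Tendsto (fun x : ℝ => (1 / x) * ∫ s in (0 : ℝ)..x, u s) atTop (nhds ℓ))
    {p q : ℝ} (hp : 0 < p) (hpq : p < q) :
    Tendsto (fun x : ℝ => ((q - p) * x)⁻¹ * ∫ s in (p * x)..(q * x), u s) atTop (nhds ℓ) := by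
  have hq := hp.trans hpq
  have h (c : ℝ) (hc : 0 < c) := hσ.comp (tendsto_id.const_mul_atTop hc)
  have hlim := (((h q hq).const_mul q).sub ((h p hp).const_mul p)).const_mul (q - p)⁻¹
  have hne : q - p ≠ 0 := (sub_pos.mpr hpq).ne'
  have hval : (q - p)⁻¹ * (q * ℓ - p * ℓ) = ℓ := by field_simp
  rw [hval] at hlim
  refine hlim.congr' ?_
  filter_upwards [eventually_gt_atTop 0] with x hx
  have hint {c : ℝ} (hc : 0 < c) : IntervalIntegrable u volume 0 (c * x) :=
    intervalIntegrable_of_locallyIntegrableOn_Ici_s5 hloc le_rfl (by positivity)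
  rw [← intervalIntegral.integral_interval_sub_left (hint hq) (hint hp)]
  simp only [Function.comp, id]
  field_simp

/-- The truncation of a real number to `[0, 1]`. -/
def unitClamp (t : ℝ) : ℝ := min 1 (max 0 t)

lemma continuous_unitClamp : Continuous unitClamp := by unfold unitClamp; fun_prop

lemma unitClamp_nonneg (t : ℝ) : 0 ≤ unitClamp t := le_min zero_le_one (le_max_left _ _)

lemma norm_unitClamp_le_one (t : ℝ) : ‖unitClamp t‖ ≤ 1 := by
  rw [Real.norm_of_nonneg (unitClamp_nonneg t)]
  exact min_le_left _ _

lemma unitClamp_of_nonpos {t : ℝ} (ht : t ≤ 0) : unitClamp t = 0 := by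
  simp [unitClamp, ht]

lemma min_one_add_le_unitClamp_add (s t : ℝ) :
    min 1 (s + t) ≤ unitClamp s + unitClamp t := by
  unfold unitClamp
  grind

lemma intervalIntegrable_unitClamp_comp {u f : ℝ → ℝ}
    (hloc : LocallyIntegrableOn u (Ici 0)) {g : ℝ → ℝ} (hg : Continuous g)
    (hf : ∀ s, f s = unitClamp (g (u s))) {p q : ℝ} (hp : 0 ≤ p) (hq : 0 ≤ q) :
    IntervalIntegrable f volume p q := by
  have hm := (intervalIntegrable_of_locallyIntegrableOn_Ici_s5 hloc hp hq).def'.aestronglyMeasurable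
  rw [funext hf]
  refine (intervalIntegrable_const (c := (1 : ℝ))).mono_fun
    ((continuous_unitClamp.comp hg).comp_aestronglyMeasurable hm) (ae_of_all _ fun s => ?_)
  simpa using norm_unitClamp_le_one (g (u s))

/-- Dominated convergence for clamped functions, in scaled variables. -/
lemma tendsto_scaled_integral_unitClamp {u : ℝ → ℝ} (hloc : LocallyIntegrableOn u (Ici 0))
    {g : ℝ → ℝ → ℝ} (hg : ∀ x, Continuous (g x)) {p q : ℝ} (hp : 0 ≤ p) (hpq : p ≤ q)
    (h : ∀ lam ∈ Ioc p q, ∀ᶠ x in atTop, g x (u (x * lam)) ≤ 0) :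
    Tendsto (fun x : ℝ => x⁻¹ * ∫ s in (x * p)..(x * q), unitClamp (g x (u s)))
      atTop (nhds 0) := by
  have hq := hp.trans hpq
  have key : Tendsto (fun x : ℝ => ∫ lam in p..q, unitClamp (g x (u (x * lam))))
      atTop (nhds (∫ _ in p..q, (0 : ℝ))) := by
    refine intervalIntegral.tendsto_integral_filter_of_dominated_convergence (fun _ => 1) ?_ ?_
      intervalIntegrable_const ?_
    · filter_upwards [eventually_gt_atTop 0] with x hx
      have hi : IntervalIntegrable (fun s => unitClamp (g x (u s))) volume (x * p) (x * q) :=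
        intervalIntegrable_unitClamp_comp hloc (hg x) (fun _ => rfl) (by positivity)
          (by positivity)
      have := hi.comp_mul_left (c := x)
      rw [mul_div_cancel_left₀ _ hx.ne', mul_div_cancel_left₀ _ hx.ne'] at this
      exact this.def'.aestronglyMeasurable
    · exact Eventually.of_forall fun x => ae_of_all _ fun s _ => norm_unitClamp_le_one _
    · refine ae_of_all _ fun lam hlam => ?_
      rw [uIoc_of_le hpq] at hlam
      refine tendsto_const_nhds.congr' ?_
      filter_upwards [h lam hlam] with x hx
      rw [unitClamp_of_nonpos hx]
  rw [intervalIntegral.integral_zero] at key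
  refine key.congr' ?_
  filter_upwards [eventually_gt_atTop 0] with x hx
  rw [intervalIntegral.integral_comp_mul_left (fun s => unitClamp (g x (u s))) hx.ne', smul_eq_mul]

/-- Away from `λ = 1`, the pointwise lower bound defining slow decrease is locally uniform. -/
lemma SlowlyDecreasing.exists_eventually_forall_le {u : ℝ → ℝ} (hsd : SlowlyDecreasing u)
    (hloc : LocallyIntegrableOn u (Ici 0)) {ε : ℝ} (hε : 0 < ε) :
    ∃ a b, 1 < a ∧ a < b ∧
      ∀ᶠ x in atTop, ∀ y ∈ Icc (a * x) (b * x), u x ≤ u y + 3 * ε := by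
  obtain ⟨b, hb, hlam⟩ := hsd.exists_eventually_lt hε
  have hb0 : 0 < b := one_pos.trans hb
  have hP : Tendsto (fun x : ℝ => x⁻¹ * ∫ s in (x * 1)..(x * b), unitClamp (u x - u s - ε))
      atTop (nhds 0) := by
    refine tendsto_scaled_integral_unitClamp (g := fun x t => u x - t - ε) hloc
      (fun x => by fun_prop) zero_le_one hb.le fun lam hl => ?_
    filter_upwards [hlam lam hl] with x hx
    rw [mul_comm x]
    linarith
  have hQ : Tendsto (fun y : ℝ => y⁻¹ * ∫ s in (y * b⁻¹)..(y * 1), unitClamp (u s - u y - ε))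
      atTop (nhds 0) := by
    refine tendsto_scaled_integral_unitClamp (g := fun y t => t - u y - ε) hloc
      (fun x => by fun_prop) (by positivity) (inv_le_one_of_one_le₀ hb.le) fun nu hn => ?_
    have hn0 : 0 < nu := (inv_pos.mpr hb0).trans hn.1
    rcases hn.2.eq_or_lt with rfl | h1
    · exact Eventually.of_forall fun y => by simp [hε.le]
    · have hmem : nu⁻¹ ∈ Ioc 1 b :=
        ⟨(one_lt_inv₀ hn0).mpr h1, (inv_le_comm₀ hn0 hb0).mpr hn.1.le⟩
      filter_upwards [(tendsto_id.atTop_mul_const hn0).eventually (hlam _ hmem)] with y hy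
      have he : nu⁻¹ * (y * nu) = y := by field_simp
      simp only [id, he] at hy
      linarith
  obtain ⟨a, ha, hab⟩ := exists_between hb
  refine ⟨a, b, ha, hab, ?_⟩
  set c := min 1 ε * (a - 1) with hc
  have hc0 : 0 < c := mul_pos (lt_min one_pos hε) (sub_pos.mpr ha)
  obtain ⟨Y, hY⟩ := eventually_atTop.mp
    (hQ.eventually (gt_mem_nhds (show 0 < c / (2 * b) by positivity)))
  filter_upwards [hP.eventually (gt_mem_nhds (half_pos hc0)), eventually_gt_atTop 0,
    eventually_ge_atTop Y] with x hPx hx hxY y hy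
  have hxy : x ≤ a * x := by nlinarith
  have hy0 : 0 < y := hx.trans_le (hxy.trans hy.1)
  have hQy := hY y (hxY.trans (hxy.trans hy.1))
  by_contra! hlt
  have hiP {p q : ℝ} (hp : 0 ≤ p) (hq : 0 ≤ q) :
      IntervalIntegrable (fun s => unitClamp (u x - u s - ε)) volume p q :=
    intervalIntegrable_unitClamp_comp hloc (g := fun t => u x - t - ε) (by fun_prop)
      (fun _ => rfl) hp hq
  have hiQ {p q : ℝ} (hp : 0 ≤ p) (hq : 0 ≤ q) :
      IntervalIntegrable (fun s => unitClamp (u s - u y - ε)) volume p q :=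
    intervalIntegrable_unitClamp_comp hloc (g := fun t => t - u y - ε) (by fun_prop)
      (fun _ => rfl) hp hq
  have hax : 0 ≤ a * x := hx.le.trans hxy
  have hlow : min 1 ε * (a * x - x) ≤ ∫ s in x..(a * x),
      (unitClamp (u x - u s - ε) + unitClamp (u s - u y - ε)) := by
    have := intervalIntegral.integral_mono_on hxy (intervalIntegrable_const (c := min 1 ε))
      ((hiP hx.le hax).add (hiQ hx.le hax)) fun s _ =>
        (min_le_min_left 1 (by linarith)).trans
          (min_one_add_le_unitClamp_add (u x - u s - ε) (u s - u y - ε))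
    rw [intervalIntegral.integral_const, smul_eq_mul, mul_comm] at this
    exact this
  rw [intervalIntegral.integral_add (hiP hx.le hax) (hiQ hx.le hax)] at hlow
  have hyb : y * b⁻¹ ≤ x := by
    rw [← div_eq_mul_inv, div_le_iff₀ hb0, mul_comm]
    exact hy.2
  have h1 : ∫ s in x..(a * x), unitClamp (u x - u s - ε) ≤
      ∫ s in (x * 1)..(x * b), unitClamp (u x - u s - ε) :=
    intervalIntegral.integral_mono_interval (by simp) hxy (by nlinarith)
      (ae_of_all _ fun s => unitClamp_nonneg _) (hiP (by positivity) (by positivity))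
  have h2 : ∫ s in x..(a * x), unitClamp (u s - u y - ε) ≤
      ∫ s in (y * b⁻¹)..(y * 1), unitClamp (u s - u y - ε) :=
    intervalIntegral.integral_mono_interval hyb hxy (by simpa using hy.1)
      (ae_of_all _ fun s => unitClamp_nonneg _) (hiQ (by positivity) (by positivity))
  rw [inv_mul_lt_iff₀ hx] at hPx
  rw [inv_mul_lt_iff₀ hy0] at hQy
  have h3 : y * (c / (2 * b)) ≤ x * (c / 2) := by
    calc y * (c / (2 * b)) ≤ b * x * (c / (2 * b)) := by gcongr; exact hy.2
      _ = x * (c / 2) := by field_simp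
  have h4 : min 1 ε * (a * x - x) = x * c := by rw [hc]; ring
  linarith

/-- Tauberian inversion of Cesàro summability for slowly decreasing functions:
if `u` is locally integrable, slowly decreasing, and its Cesàro mean
`σ(x) = (1/x) ∫₀ˣ u(s) ds` tends to `ℓ`, then `u(x) → ℓ` as `x → ∞`. -/
theorem tendsto_of_cesaro_tendsto_of_slowlyDecreasing
    (u : ℝ → ℝ) (ℓ : ℝ)
    (hloc : LocallyIntegrableOn u (Ici 0))
    (hsd : SlowlyDecreasing u)
    (hσ : Tendsto (fun x : ℝ => (1 / x) * ∫ s in (0 : ℝ)..x, u s) atTop (nhds ℓ)) :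
    Tendsto u atTop (nhds ℓ) := by
  refine Metric.tendsto_atTop.mpr fun e he => ?_
  obtain ⟨a, b, ha, hab, hunif⟩ :=
    hsd.exists_eventually_forall_le hloc (show 0 < e / 6 by positivity)
  have ha0 : 0 < a := one_pos.trans ha
  have hb0 : 0 < b := ha0.trans hab
  have hinv : b⁻¹ < a⁻¹ := inv_strictAnti₀ ha0 hab
  have hup := tendsto_average_of_cesaro_tendsto hloc hσ ha0 hab
  have hdown := tendsto_average_of_cesaro_tendsto hloc hσ (inv_pos.mpr hb0) hinv
  obtain ⟨X, hX⟩ := eventually_atTop.mp hunif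
  refine eventually_atTop.mp ?_
  filter_upwards [hup.eventually (gt_mem_nhds (show ℓ < ℓ + e / 2 by linarith)),
    hdown.eventually (lt_mem_nhds (show ℓ - e / 2 < ℓ by linarith)),
    eventually_gt_atTop 0, eventually_ge_atTop X, eventually_ge_atTop (b * X)]
    with x hux hdx hx hxX hbX
  have hint {p q : ℝ} (hp : 0 < p) (hq : 0 < q) : IntervalIntegrable u volume (p * x) (q * x) :=
    intervalIntegrable_of_locallyIntegrableOn_Ici_s5 hloc (by positivity) (by positivity)
  have hba : 0 < (b - a) * x := mul_pos (sub_pos.mpr hab) hx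
  have hiba : 0 < (a⁻¹ - b⁻¹) * x := mul_pos (sub_pos.mpr hinv) hx
  rw [inv_mul_lt_iff₀ hba] at hux
  rw [lt_inv_mul_iff₀ hiba] at hdx
  have h1 := intervalIntegral.integral_mono_on (by gcongr)
    (intervalIntegrable_const (c := u x - e / 2)) (hint ha0 hb0) fun y hy => by
      linarith [hX x hxX y hy]
  have h2 := intervalIntegral.integral_mono_on (by gcongr)
    (hint (inv_pos.mpr hb0) (inv_pos.mpr ha0))
    (intervalIntegrable_const (c := u x + e / 2)) fun y hy => by
      have hy1 : x ≤ b * y := (inv_mul_le_iff₀ hb0).mp hy.1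
      have hy2 : a * y ≤ x := (le_inv_mul_iff₀ ha0).mp hy.2
      have hyX : X ≤ y := le_of_mul_le_mul_left (hbX.trans hy1) hb0
      linarith [hX y hyX x ⟨hy2, hy1⟩]
  rw [intervalIntegral.integral_const, smul_eq_mul, ← sub_mul] at h1 h2
  have h3 := lt_of_mul_lt_mul_left (h1.trans_lt hux) hba.le
  have h4 := lt_of_mul_lt_mul_left (hdx.trans_le h2) hiba.le
  rw [Real.dist_eq, abs_lt]
  constructor <;> linarith
end

section
/- Let u : [0,∞) → ℝ be a nonnegative, locally integrable, slowly decreasing function, and suppose that for every t > 0 the improper integral f(t) := t ∫₀^∞ u(x) e^{−t x} dx converges. If f(t) converges to a finite limit ℓ ∈ ℝ as t → 0⁺, then u(x) → ℓ as x → +∞. -/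
open Filter Set MeasureTheory

/-- Pointwise unfolding of slow decrease; the threshold in `x` may depend on the dilation. -/
lemma SlowlyDecreasing.exists_forall_eventually {u : ℝ → ℝ} (h : SlowlyDecreasing u)
    {ε : ℝ} (hε : 0 < ε) :
    ∃ d > 1, ∀ r ∈ Ioo 1 d, ∀ᶠ x in atTop, u x - ε < u (r * x) := by
  have h1 : ((-ε : ℝ) : EReal) < 0 := by exact_mod_cast neg_lt_zero.mpr hε
  have h2 := eventually_lt_of_lt_liminf (lt_of_lt_of_le h1 h)
  obtain ⟨d, hd, hsub⟩ := (mem_nhdsGT_iff_exists_Ioo_subset).mp h2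
  refine ⟨d, hd, fun r hr => ?_⟩
  have hrd : ((-ε : ℝ) : EReal) <
      liminf (fun x : ℝ => ((u (r * x) - u x : ℝ) : EReal)) atTop := hsub hr
  have h3 := eventually_lt_of_lt_liminf hrd
  filter_upwards [h3] with x hx
  have := EReal.coe_lt_coe_iff.mp hx
  linarith

/-- A form of Fatou's lemma for real integrals with an eventual pointwise lower bound. -/
lemma integral_le_of_tendsto_of_eventually_le {α ι : Type*} [MeasurableSpace α] {μ : Measure α}
    {l : Filter ι} [l.IsCountablyGenerated] [l.NeBot] {F : ι → α → ℝ} {G : α → ℝ} {A : ℝ}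
    (hF : ∀ i, AEStronglyMeasurable (F i) μ) (hFint : ∀ᶠ i in l, Integrable (F i) μ)
    (hF0 : ∀ᶠ i in l, 0 ≤ᵐ[μ] F i)
    (hG : Integrable G μ) (hG0 : 0 ≤ᵐ[μ] G)
    (hle : ∀ᵐ s ∂μ, ∀ᶠ i in l, G s ≤ F i s)
    (hA : Tendsto (fun i => ∫ s, F i s ∂μ) l (nhds A)) :
    ∫ s, G s ∂μ ≤ A := by
  have hA0 : 0 ≤ A := ge_of_tendsto hA (hF0.mono fun i hi => integral_nonneg_of_ae hi)
  have hlim : Tendsto (fun i => ∫⁻ s, ENNReal.ofReal (F i s) ∂μ) l (nhds (ENNReal.ofReal A)) := by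
    refine (ENNReal.tendsto_ofReal hA).congr' ?_
    filter_upwards [hFint, hF0] with i h1 h2
    exact ofReal_integral_eq_lintegral_ofReal h1 h2
  rw [← ENNReal.ofReal_le_ofReal_iff hA0, ofReal_integral_eq_lintegral_ofReal hG hG0]
  calc ∫⁻ s, ENNReal.ofReal (G s) ∂μ
      ≤ ∫⁻ s, liminf (fun i => ENNReal.ofReal (F i s)) l ∂μ := by
        refine lintegral_mono_ae (hle.mono fun s hs => ?_)
        exact le_liminf_of_le (by isBoundedDefault)
          (hs.mono fun i hi => ENNReal.ofReal_le_ofReal hi)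
    _ ≤ liminf (fun i => ∫⁻ s, ENNReal.ofReal (F i s) ∂μ) l :=
        lintegral_liminf_le' fun i => (hF i).aemeasurable.ennreal_ofReal
    _ = ENNReal.ofReal A := hlim.liminf_eq

lemma integrableOn_mul_comp_exp_neg {h g : ℝ → ℝ} (hh : IntegrableOn h (Ioi 0))
    (hg : Continuous g) : IntegrableOn (fun s => h s * g (Real.exp (-s))) (Ioi 0) := by
  obtain ⟨C, hC⟩ := isCompact_Icc.exists_bound_of_continuousOn (s := Icc (0 : ℝ) 1)
    hg.continuousOn
  refine Integrable.mul_bdd (c := C) hh (by fun_prop) ?_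
  filter_upwards [ae_restrict_mem measurableSet_Ioi] with s hs
  exact hC _ ⟨(Real.exp_pos _).le, Real.exp_le_one_iff.mpr (neg_nonpos.mpr (le_of_lt hs))⟩

lemma abs_integral_mul_comp_exp_neg_sub_le {h p g : ℝ → ℝ} {η : ℝ}
    (hh : IntegrableOn h (Ioi 0)) (hh0 : ∀ s > 0, 0 ≤ h s)
    (hp : Continuous p) (hg : Continuous g) (hpg : ∀ y ∈ Icc (0 : ℝ) 1, |p y - g y| ≤ η) :
    |(∫ s in Ioi 0, h s * p (Real.exp (-s))) - ∫ s in Ioi 0, h s * g (Real.exp (-s))|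
      ≤ η * ∫ s in Ioi 0, h s := by
  rw [← integral_sub (integrableOn_mul_comp_exp_neg hh hp) (integrableOn_mul_comp_exp_neg hh hg),
    ← integral_const_mul, ← Real.norm_eq_abs]
  refine norm_integral_le_of_norm_le (hh.const_mul η) ?_
  filter_upwards [ae_restrict_mem measurableSet_Ioi] with s hs
  have h1 := hpg _ ⟨(Real.exp_pos (-s)).le,
    Real.exp_le_one_iff.mpr (neg_nonpos.mpr (le_of_lt hs))⟩
  rw [← mul_sub, norm_mul, Real.norm_eq_abs, Real.norm_eq_abs, abs_of_nonneg (hh0 s hs), mul_comm]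
  exact mul_le_mul_of_nonneg_right h1 (hh0 s hs)

/-- For a nonnegative integrand, convergence of the improper Laplace integral is absolute. -/
lemma integrableOn_laplace_of_tendsto {u : ℝ → ℝ} {t a : ℝ} (ht : 0 < t)
    (hpos : ∀ x, 0 ≤ x → 0 ≤ u x) (hloc : LocallyIntegrableOn u (Ici 0))
    (hlim : Tendsto (fun X : ℝ => t * ∫ x in (0 : ℝ)..X, u x * Real.exp (-(t * x)))
      atTop (nhds a)) :
    IntegrableOn (fun x => u x * Real.exp (-(t * x))) (Ioi 0) ∧
      t * ∫ x in Ioi 0, u x * Real.exp (-(t * x)) = a := by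
  have hint : IntegrableOn (fun x => u x * Real.exp (-(t * x))) (Ioi 0) := by
    refine integrableOn_Ioi_of_intervalIntegral_norm_tendsto (l := atTop) (b := id)
      (t⁻¹ * a) 0 (fun X => ?_) tendsto_id ?_
    · have h1 : IntegrableOn u (Icc 0 X) :=
        hloc.integrableOn_compact_subset Icc_subset_Ici_self isCompact_Icc
      exact (h1.mul_continuousOn (by fun_prop) isCompact_Icc).mono_set Ioc_subset_Icc_self
    · refine (hlim.const_mul t⁻¹).congr' ?_
      filter_upwards [eventually_ge_atTop 0] with X hX
      rw [inv_mul_cancel_left₀ ht.ne']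
      refine intervalIntegral.integral_congr fun x hx => ?_
      rw [uIcc_of_le hX] at hx
      exact (Real.norm_of_nonneg (mul_nonneg (hpos x hx.1) (Real.exp_pos _).le)).symm
  exact ⟨hint, tendsto_nhds_unique
    ((intervalIntegral_tendsto_integral_Ioi 0 hint tendsto_id).const_mul t) hlim⟩

lemma integrableOn_laplace_dilation {u : ℝ → ℝ} {X : ℝ} (hX : 0 < X)
    (hint : ∀ t > 0, IntegrableOn (fun x => u x * Real.exp (-(t * x))) (Ioi 0)) :
    IntegrableOn (fun s => u (X * s) * Real.exp (-s)) (Ioi 0) := by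
  have h := (integrableOn_Ioi_comp_mul_left_iff
    (fun x => u x * Real.exp (-(X⁻¹ * x))) 0 hX).mpr
      (by simpa using hint X⁻¹ (inv_pos.mpr hX))
  simpa [inv_mul_cancel_left₀ hX.ne'] using h

lemma integral_exp_neg_mul_pow (n : ℕ) :
    ∫ s in Ioi (0 : ℝ), Real.exp (-s) * Real.exp (-s) ^ n = ((n : ℝ) + 1)⁻¹ := by
  have hn : -((n : ℝ) + 1) < 0 := by linarith [n.cast_nonneg (α := ℝ)]
  have h := integral_exp_mul_Ioi hn 0
  rw [mul_zero, Real.exp_zero, neg_div_neg_eq, one_div] at h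
  rw [← h]
  congr with s
  rw [← Real.exp_nat_mul, ← Real.exp_add]
  ring_nf

/-- Karamata's theorem for polynomial weights in `exp (-s)`. -/
lemma tendsto_integral_dilation_polynomial {u : ℝ → ℝ} {ℓ : ℝ}
    (hint : ∀ t > 0, IntegrableOn (fun x => u x * Real.exp (-(t * x))) (Ioi 0))
    (hlim : Tendsto (fun t => t * ∫ x in Ioi 0, u x * Real.exp (-(t * x)))
      (nhdsWithin 0 (Ioi 0)) (nhds ℓ)) (p : Polynomial ℝ) :
    Tendsto (fun X => ∫ s in Ioi 0, (u (X * s) * Real.exp (-s)) * p.eval (Real.exp (-s)))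
      atTop (nhds (ℓ * ∫ s in Ioi 0, Real.exp (-s) * p.eval (Real.exp (-s)))) := by
  have hexp : IntegrableOn (fun s : ℝ => Real.exp (-s)) (Ioi 0) := by
    simpa using exp_neg_integrableOn_Ioi 0 one_pos
  induction p using Polynomial.induction_on' with
  | add p q hp hq =>
    have h := hp.add hq
    rw [← mul_add, ← integral_add (integrableOn_mul_comp_exp_neg hexp p.continuous)
      (integrableOn_mul_comp_exp_neg hexp q.continuous)] at h
    simp only [Polynomial.eval_add, mul_add] at h ⊢
    refine h.congr' ?_
    filter_upwards [eventually_gt_atTop 0] with X hX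
    have hX' := integrableOn_laplace_dilation hX hint
    exact (integral_add (integrableOn_mul_comp_exp_neg hX' p.continuous)
      (integrableOn_mul_comp_exp_neg hX' q.continuous)).symm
  | monomial n a =>
    have hn : (0 : ℝ) < n + 1 := by positivity
    have hT : Tendsto (fun X : ℝ => (n + 1 : ℝ) * X⁻¹) atTop (nhdsWithin 0 (Ioi 0)) := by
      refine tendsto_nhdsWithin_iff.mpr
        ⟨by simpa using (tendsto_inv_atTop_zero (𝕜 := ℝ)).const_mul (n + 1 : ℝ), ?_⟩
      filter_upwards [eventually_gt_atTop 0] with X hX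
      exact mul_pos hn (inv_pos.mpr hX)
    have h := ((hlim.comp hT).const_mul ((n + 1 : ℝ)⁻¹ * a))
    have e : ℓ * ∫ s in Ioi 0, Real.exp (-s) * (Polynomial.monomial n a).eval (Real.exp (-s))
        = (n + 1 : ℝ)⁻¹ * a * ℓ := by
      simp only [Polynomial.eval_monomial, mul_left_comm _ a]
      rw [integral_const_mul, integral_exp_neg_mul_pow]
      ring
    rw [e]
    refine h.congr' ?_
    filter_upwards [eventually_gt_atTop 0] with X hX
    have h2 := integral_comp_mul_left_Ioi
      (fun x => u x * Real.exp (-((n + 1 : ℝ) * X⁻¹ * x))) 0 hX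
    rw [mul_zero, smul_eq_mul] at h2
    have h3 : ∀ s, (u (X * s) * Real.exp (-s)) * (Polynomial.monomial n a).eval (Real.exp (-s))
        = a * (u (X * s) * Real.exp (-((n + 1 : ℝ) * X⁻¹ * (X * s)))) := by
      intro s
      have : Real.exp (-((n + 1 : ℝ) * X⁻¹ * (X * s))) = Real.exp (-s) * Real.exp (-s) ^ n := by
        rw [← Real.exp_nat_mul, ← Real.exp_add]
        congr 1
        field_simp
        ring
      rw [this, Polynomial.eval_monomial]
      ring
    simp only [h3, Function.comp]
    rw [integral_const_mul, h2]
    field_simp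

/-- Karamata's theorem for continuous weights in `exp (-s)`. -/
lemma tendsto_integral_dilation_continuous {u g : ℝ → ℝ} {ℓ : ℝ}
    (hpos : ∀ x, 0 ≤ x → 0 ≤ u x)
    (hint : ∀ t > 0, IntegrableOn (fun x => u x * Real.exp (-(t * x))) (Ioi 0))
    (hlim : Tendsto (fun t => t * ∫ x in Ioi 0, u x * Real.exp (-(t * x)))
      (nhdsWithin 0 (Ioi 0)) (nhds ℓ)) (hg : Continuous g) :
    Tendsto (fun X => ∫ s in Ioi 0, (u (X * s) * Real.exp (-s)) * g (Real.exp (-s)))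
      atTop (nhds (ℓ * ∫ s in Ioi 0, Real.exp (-s) * g (Real.exp (-s)))) := by
  have hexp : IntegrableOn (fun s : ℝ => Real.exp (-s)) (Ioi 0) := by
    simpa using exp_neg_integrableOn_Ioi 0 one_pos
  have hone := tendsto_integral_dilation_polynomial hint hlim 1
  simp only [Polynomial.eval_one, mul_one, integral_exp_neg_Ioi_zero] at hone
  rw [Metric.tendsto_nhds]
  intro ε hε
  have hη : 0 < ε / (2 * (|ℓ| + 1)) := by positivity
  obtain ⟨p, hp⟩ := exists_polynomial_near_of_continuousOn 0 1 g hg.continuousOn _ hη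
  have hp' : ∀ y ∈ Icc (0 : ℝ) 1, |p.eval y - g y| ≤ ε / (2 * (|ℓ| + 1)) :=
    fun y hy => (hp y hy).le
  have hB := abs_integral_mul_comp_exp_neg_sub_le hexp (fun s _ => (Real.exp_pos _).le)
    p.continuous hg hp'
  rw [integral_exp_neg_Ioi_zero, mul_one] at hB
  have hbound : Tendsto (fun X => ε / (2 * (|ℓ| + 1)) * (∫ s in Ioi 0, u (X * s) * Real.exp (-s))
      + |(∫ s in Ioi 0, (u (X * s) * Real.exp (-s)) * p.eval (Real.exp (-s)))
        - ℓ * ∫ s in Ioi 0, Real.exp (-s) * p.eval (Real.exp (-s))|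
      + |ℓ| * (ε / (2 * (|ℓ| + 1)))) atTop
      (nhds (ε / (2 * (|ℓ| + 1)) * ℓ + 0 + |ℓ| * (ε / (2 * (|ℓ| + 1))))) := by
    refine ((hone.const_mul _).add ?_).add_const _
    simpa using ((tendsto_integral_dilation_polynomial hint hlim p).sub_const
      (ℓ * ∫ s in Ioi 0, Real.exp (-s) * p.eval (Real.exp (-s)))).abs
  have hlt : ε / (2 * (|ℓ| + 1)) * ℓ + 0 + |ℓ| * (ε / (2 * (|ℓ| + 1))) < ε := by
    have h1 : ε / (2 * (|ℓ| + 1)) * (2 * (|ℓ| + 1)) = ε := div_mul_cancel₀ _ (by positivity)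
    nlinarith [mul_le_mul_of_nonneg_left (le_abs_self ℓ) hη.le]
  filter_upwards [hbound.eventually_lt_const hlt, eventually_gt_atTop 0] with X hX hX0
  have hA := abs_integral_mul_comp_exp_neg_sub_le (integrableOn_laplace_dilation hX0 hint)
    (fun s hs => mul_nonneg (hpos _ (mul_pos hX0 hs).le) (Real.exp_pos _).le)
    p.continuous hg hp'
  rw [Real.dist_eq]
  refine lt_of_le_of_lt ?_ hX
  have hB' := mul_le_mul_of_nonneg_left hB (abs_nonneg ℓ)
  rw [← abs_mul, mul_sub] at hB'
  rw [abs_le] at *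
  obtain ⟨hA1, hA2⟩ := hA
  obtain ⟨hB1, hB2⟩ := hB'
  constructor
  · linarith [neg_abs_le ((∫ s in Ioi 0, (u (X * s) * Real.exp (-s)) * p.eval (Real.exp (-s)))
        - ℓ * ∫ s in Ioi 0, Real.exp (-s) * p.eval (Real.exp (-s)))]
  · linarith [le_abs_self ((∫ s in Ioi 0, (u (X * s) * Real.exp (-s)) * p.eval (Real.exp (-s)))
        - ℓ * ∫ s in Ioi 0, Real.exp (-s) * p.eval (Real.exp (-s)))]

/-- Every interval in `(0, ∞)` carries a nontrivial continuous nonnegative weight along which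
the dilated averages of `u` converge to `ℓ`. -/
lemma exists_weight_tendsto_integral_dilation {u : ℝ → ℝ} {ℓ c d : ℝ}
    (hpos : ∀ x, 0 ≤ x → 0 ≤ u x)
    (hint : ∀ t > 0, IntegrableOn (fun x => u x * Real.exp (-(t * x))) (Ioi 0))
    (hlim : Tendsto (fun t => t * ∫ x in Ioi 0, u x * Real.exp (-(t * x)))
      (nhdsWithin 0 (Ioi 0)) (nhds ℓ)) (hc : 0 < c) (hcd : c < d) :
    ∃ w : ℝ → ℝ, (∀ s, 0 ≤ w s) ∧ (∀ s ∉ Ioo c d, w s = 0) ∧ IntegrableOn w (Ioi 0) ∧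
      0 < ∫ s in Ioi 0, w s ∧
      (∀ X > 0, IntegrableOn (fun s => u (X * s) * w s) (Ioi 0)) ∧
      Tendsto (fun X => ∫ s in Ioi 0, u (X * s) * w s) atTop
        (nhds (ℓ * ∫ s in Ioi 0, w s)) := by
  have hexp : IntegrableOn (fun s : ℝ => Real.exp (-s)) (Ioi 0) := by
    simpa using exp_neg_integrableOn_Ioi 0 one_pos
  set g : ℝ → ℝ := fun y => max 0 (min (y - Real.exp (-d)) (Real.exp (-c) - y)) with hgdef
  have hg : Continuous g := by fun_prop
  have hg0 : ∀ y, 0 ≤ g y := fun y => le_max_left _ _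
  have hgsupp : ∀ s, g (Real.exp (-s)) ≠ 0 ↔ s ∈ Ioo c d := by
    intro s
    rw [← (hg0 _).lt_iff_ne']
    simp only [hgdef, lt_max_iff, lt_irrefl, false_or, lt_min_iff, sub_pos, Real.exp_lt_exp,
      neg_lt_neg_iff, mem_Ioo]
    exact and_comm
  have hw0 : ∀ s, 0 ≤ Real.exp (-s) * g (Real.exp (-s)) :=
    fun s => mul_nonneg (Real.exp_pos _).le (hg0 _)
  have hwint := integrableOn_mul_comp_exp_neg hexp hg
  refine ⟨fun s => Real.exp (-s) * g (Real.exp (-s)), hw0, fun s hs => ?_, hwint, ?_, ?_, ?_⟩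
  · rw [← hgsupp, not_not] at hs
    simp [hs]
  · rw [setIntegral_pos_iff_support_of_nonneg_ae (Eventually.of_forall hw0) hwint]
    have : Ioo c d ⊆
        Function.support (fun s => Real.exp (-s) * g (Real.exp (-s))) ∩ Ioi 0 := fun s hs =>
      ⟨mul_ne_zero (Real.exp_pos _).ne' ((hgsupp s).mpr hs), hc.trans hs.1⟩
    refine lt_of_lt_of_le ?_ (measure_mono this)
    simpa using hcd
  · intro X hX
    simpa only [mul_assoc] using
      integrableOn_mul_comp_exp_neg (integrableOn_laplace_dilation hX hint) hg
  · simpa only [mul_assoc] using tendsto_integral_dilation_continuous hpos hint hlim hg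

/-- A nonnegative slowly decreasing function whose Laplace means tend to `ℓ` is eventually below
every number above `ℓ`. -/
lemma SlowlyDecreasing.eventually_lt_of_laplace_tendsto {u : ℝ → ℝ} {ℓ a : ℝ}
    (hsd : SlowlyDecreasing u) (hpos : ∀ x, 0 ≤ x → 0 ≤ u x)
    (hint : ∀ t > 0, IntegrableOn (fun x => u x * Real.exp (-(t * x))) (Ioi 0))
    (hlim : Tendsto (fun t => t * ∫ x in Ioi 0, u x * Real.exp (-(t * x)))
      (nhdsWithin 0 (Ioi 0)) (nhds ℓ)) (hℓ : 0 ≤ ℓ) (ha : ℓ < a) :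
    ∀ᶠ x in atTop, u x < a := by
  by_contra hcon
  obtain ⟨d, hd, hslow⟩ := hsd.exists_forall_eventually (half_pos (sub_pos.mpr ha))
  obtain ⟨w, hw0, hwsupp, hwint, hW, huw, hT⟩ :=
    exists_weight_tendsto_integral_dilation hpos hint hlim one_pos hd
  have hne : (atTop ⊓ 𝓟 {x : ℝ | ¬ u x < a}).NeBot :=
    frequently_mem_iff_neBot.mp (not_eventually.mp hcon)
  have hb : 0 ≤ (a + ℓ) / 2 := by linarith
  have key := integral_le_of_tendsto_of_eventually_le
    (μ := volume.restrict (Ioi (0 : ℝ))) (l := atTop ⊓ 𝓟 {x : ℝ | ¬ u x < a})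
    (F := fun X s => u (max X 1 * s) * w s) (G := fun s => (a + ℓ) / 2 * w s)
    (fun X => (huw _ (by positivity)).aestronglyMeasurable)
    (Eventually.of_forall fun X => huw _ (by positivity))
    (Eventually.of_forall fun X => by
      filter_upwards [ae_restrict_mem measurableSet_Ioi] with s hs
      have hs' : 0 < s := hs
      exact mul_nonneg (hpos _ (by positivity)) (hw0 s))
    (hwint.const_mul _) (Eventually.of_forall fun s => mul_nonneg hb (hw0 s))
    (Eventually.of_forall fun s => by
      by_cases hs : s ∈ Ioo 1 d
      · filter_upwards [(hslow s hs).filter_mono inf_le_left,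
          (eventually_ge_atTop 1).filter_mono inf_le_left,
          mem_inf_of_right (mem_principal_self _)] with X h1 h2 h3
        rw [max_eq_left h2, mul_comm X]
        have h4 : a ≤ u X := not_lt.mp h3
        exact mul_le_mul_of_nonneg_right (by linarith) (hw0 s)
      · simp [hwsupp s hs])
    ((hT.comp (tendsto_atTop_mono (fun X => le_max_left X 1) tendsto_id)).mono_left inf_le_left)
  rw [integral_const_mul] at key
  have := le_of_mul_le_mul_right key hW
  linarith

/-- A nonnegative slowly decreasing function whose Laplace means tend to `ℓ` is eventually above
every number below `ℓ`. -/
lemma SlowlyDecreasing.eventually_gt_of_laplace_tendsto {u : ℝ → ℝ} {ℓ a : ℝ}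
    (hsd : SlowlyDecreasing u) (hpos : ∀ x, 0 ≤ x → 0 ≤ u x)
    (hint : ∀ t > 0, IntegrableOn (fun x => u x * Real.exp (-(t * x))) (Ioi 0))
    (hlim : Tendsto (fun t => t * ∫ x in Ioi 0, u x * Real.exp (-(t * x)))
      (nhdsWithin 0 (Ioi 0)) (nhds ℓ)) (hℓ : 0 ≤ ℓ) (ha : a < ℓ) :
    ∀ᶠ x in atTop, a < u x := by
  by_contra hcon
  obtain ⟨d, hd, hslow⟩ := hsd.exists_forall_eventually (half_pos (sub_pos.mpr ha))
  have hd0 : 0 < d := one_pos.trans hd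
  obtain ⟨w, hw0, hwsupp, hwint, hW, huw, hT⟩ :=
    exists_weight_tendsto_integral_dilation hpos hint hlim (inv_pos.mpr hd0)
      (inv_lt_one_of_one_lt₀ hd)
  have hne : (atTop ⊓ 𝓟 {x : ℝ | ¬ a < u x}).NeBot :=
    frequently_mem_iff_neBot.mp (not_eventually.mp hcon)
  obtain ⟨R, hR⟩ := eventually_atTop.mp
    (hsd.eventually_lt_of_laplace_tendsto hpos hint hlim hℓ (lt_add_one ℓ))
  have hmax : Tendsto (fun X : ℝ => max X 1) atTop atTop :=
    tendsto_atTop_mono (fun X => le_max_left X 1) tendsto_id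
  have hsubint : ∀ X : ℝ,
      IntegrableOn (fun s => (ℓ + 1) * w s - u (max X 1 * s) * w s) (Ioi 0) :=
    fun X => (hwint.const_mul _).sub (huw _ (by positivity))
  have key := integral_le_of_tendsto_of_eventually_le
    (μ := volume.restrict (Ioi (0 : ℝ))) (l := atTop ⊓ 𝓟 {x : ℝ | ¬ a < u x})
    (F := fun X s => (ℓ + 1) * w s - u (max X 1 * s) * w s)
    (G := fun s => (ℓ + 1 - (a + ℓ) / 2) * w s)
    (A := (ℓ + 1) * (∫ s in Ioi 0, w s) - ℓ * ∫ s in Ioi 0, w s)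
    (fun X => (hsubint X).aestronglyMeasurable)
    (Eventually.of_forall hsubint)
    (by
      filter_upwards [(eventually_ge_atTop (R * d)).filter_mono inf_le_left] with X hX
      refine Eventually.of_forall fun s => ?_
      by_cases hs : s ∈ Ioo d⁻¹ 1
      · have h1 : R ≤ max X 1 * s := by
          have h2 : R * d * d⁻¹ ≤ max X 1 * s := by
            have h3 : 0 < d⁻¹ := inv_pos.mpr hd0
            calc R * d * d⁻¹ ≤ max X 1 * d⁻¹ :=
                  mul_le_mul_of_nonneg_right (hX.trans (le_max_left _ _)) h3.le
              _ ≤ max X 1 * s := mul_le_mul_of_nonneg_left hs.1.le (by positivity)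
          rwa [mul_inv_cancel_right₀ hd0.ne'] at h2
        change 0 ≤ (ℓ + 1) * w s - u (max X 1 * s) * w s
        rw [← sub_mul]
        exact mul_nonneg (by linarith [hR _ h1]) (hw0 s)
      · simp [hwsupp s hs])
    (hwint.const_mul _)
    (Eventually.of_forall fun s => mul_nonneg (by linarith) (hw0 s))
    (Eventually.of_forall fun s => by
      by_cases hs : s ∈ Ioo d⁻¹ 1
      · have hs0 : 0 < s := (inv_pos.mpr hd0).trans hs.1
        have hs' : s⁻¹ ∈ Ioo 1 d := ⟨(one_lt_inv₀ hs0).mpr hs.2, inv_lt_of_inv_lt₀ hd0 hs.1⟩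
        have hXs : Tendsto (fun X : ℝ => X * s) atTop atTop := tendsto_id.atTop_mul_const hs0
        filter_upwards [(hXs.eventually (hslow s⁻¹ hs')).filter_mono inf_le_left,
          (eventually_ge_atTop 1).filter_mono inf_le_left,
          mem_inf_of_right (mem_principal_self _)] with X h1 h2 h3
        rw [max_eq_left h2, ← sub_mul]
        have h4 : u X ≤ a := not_lt.mp h3
        rw [mul_comm X s, inv_mul_cancel_left₀ hs0.ne'] at h1
        rw [mul_comm X s]
        exact mul_le_mul_of_nonneg_right (by linarith) (hw0 s)
      · simp [hwsupp s hs])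
    (by
      refine (((hT.comp hmax).const_sub _).congr fun X => ?_).mono_left inf_le_left
      rw [integral_sub (hwint.const_mul _) (huw _ (by positivity)), integral_const_mul]
      rfl)
  rw [integral_const_mul, ← sub_mul] at key
  have := le_of_mul_le_mul_right key hW
  linarith


/-- Tauberian inversion of the Abel–Laplace summability: if `u` is nonnegative,
locally integrable and slowly decreasing, the improper integrals
`f(t) = t ∫₀^∞ u(x) e^{-tx} dx` converge for every `t > 0`, and `f(t) → ℓ` as
`t → 0⁺`, then `u(x) → ℓ` as `x → ∞`. -/
theorem tendsto_of_abelLaplace_tendsto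
    (u : ℝ → ℝ) (f : ℝ → ℝ) (ℓ : ℝ)
    (hpos : ∀ x, 0 ≤ x → 0 ≤ u x)
    (hloc : LocallyIntegrableOn u (Ici 0))
    (hsd : SlowlyDecreasing u)
    (hf : ∀ t : ℝ, 0 < t →
      Tendsto (fun X : ℝ => t * ∫ x in (0 : ℝ)..X, u x * Real.exp (-(t * x)))
        atTop (nhds (f t)))
    (h0 : Tendsto f (nhdsWithin 0 (Ioi 0)) (nhds ℓ)) :
    Tendsto u atTop (nhds ℓ) := by
  have hint : ∀ t > 0, IntegrableOn (fun x => u x * Real.exp (-(t * x))) (Ioi 0) :=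
    fun t ht => (integrableOn_laplace_of_tendsto ht hpos hloc (hf t ht)).1
  have hlim : Tendsto (fun t => t * ∫ x in Ioi 0, u x * Real.exp (-(t * x)))
      (nhdsWithin 0 (Ioi 0)) (nhds ℓ) := by
    refine h0.congr' ?_
    filter_upwards [self_mem_nhdsWithin] with t ht
    exact (integrableOn_laplace_of_tendsto ht hpos hloc (hf t ht)).2.symm
  have hℓ : 0 ≤ ℓ := by
    refine ge_of_tendsto hlim ?_
    filter_upwards [self_mem_nhdsWithin] with t ht
    exact mul_nonneg (le_of_lt ht) (setIntegral_nonneg measurableSet_Ioi fun x hx =>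
      mul_nonneg (hpos x (le_of_lt hx)) (Real.exp_pos _).le)
  exact tendsto_order.mpr
    ⟨fun a ha => hsd.eventually_gt_of_laplace_tendsto hpos hint hlim hℓ ha,
      fun a ha => hsd.eventually_lt_of_laplace_tendsto hpos hint hlim hℓ ha⟩
end

section
/- (Generalized Wiener–Ikehara theorem on the real axis.) Let α : [0,∞) → ℝ be a nonnegative locally integrable function, let μ ≥ 0 be a real number, and suppose that for every real s > μ the improper integral g(s) := ∫₀^∞ α(x) e^{−s x} dx converges. Assume there exist finite real numbers A and ℓ such that lim_{s→μ⁺} ( g(s) − A/(s − μ) ) = ℓ, and assume the nonnegative function φ(x) := e^{−μ x} α(x) is slowly decreasing. Then e^{−μ x} α(x) → A as x → +∞, i.e. α(x) ∼ A e^{μ x} as x → +∞. -/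
open Filter Set MeasureTheory

/-- A Laplace transformable function is integrable against continuous weights in `exp (-x)`. -/
lemma integrableOn_mul_exp_mul_comp_exp {φ h : ℝ → ℝ} (hh : Continuous h)
    (hφ : IntegrableOn (fun x => φ x * Real.exp (-x)) (Ioi 0)) :
    IntegrableOn (fun x => φ x * (Real.exp (-x) * h (Real.exp (-x)))) (Ioi 0) := by
  obtain ⟨C, hC⟩ := isCompact_Icc.exists_bound_of_continuousOn (s := Icc (0 : ℝ) 1) hh.continuousOn
  have := Integrable.mul_bdd (c := C) (μ := volume.restrict (Ioi 0))
    (f := fun x => φ x * Real.exp (-x)) (g := fun x => h (Real.exp (-x)))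
    hφ (hh.comp (Real.continuous_exp.comp continuous_neg)).aestronglyMeasurable
    (by
      filter_upwards [ae_restrict_mem measurableSet_Ioi] with x hx
      exact hC _ ⟨(Real.exp_pos _).le, Real.exp_le_one_iff.2 (neg_nonpos.2 (le_of_lt hx))⟩)
  simpa only [IntegrableOn, mul_assoc] using this

lemma abs_integral_mul_exp_mul_comp_exp_sub_le {φ h k : ℝ → ℝ} {δ : ℝ}
    (hh : Continuous h) (hk : Continuous k) (hpos : ∀ x, 0 < x → 0 ≤ φ x)
    (hφ : IntegrableOn (fun x => φ x * Real.exp (-x)) (Ioi 0))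
    (hδ : ∀ u ∈ Icc (0 : ℝ) 1, |h u - k u| ≤ δ) :
    |(∫ x in Ioi 0, φ x * (Real.exp (-x) * h (Real.exp (-x)))) -
      ∫ x in Ioi 0, φ x * (Real.exp (-x) * k (Real.exp (-x)))| ≤
      δ * ∫ x in Ioi 0, φ x * Real.exp (-x) := by
  rw [← integral_sub (integrableOn_mul_exp_mul_comp_exp hh hφ)
    (integrableOn_mul_exp_mul_comp_exp hk hφ), ← integral_const_mul, ← Real.norm_eq_abs]
  refine norm_integral_le_of_norm_le (hφ.const_mul δ) ?_
  filter_upwards [ae_restrict_mem measurableSet_Ioi] with x hx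
  have h0 : 0 ≤ φ x * Real.exp (-x) := mul_nonneg (hpos x hx) (Real.exp_pos _).le
  have h1 := hδ (Real.exp (-x))
    ⟨(Real.exp_pos _).le, Real.exp_le_one_iff.2 (neg_nonpos.2 (le_of_lt hx))⟩
  rw [Real.norm_eq_abs, ← mul_sub, ← mul_sub, ← mul_assoc, abs_mul, abs_of_nonneg h0, mul_comm]
  exact mul_le_mul_of_nonneg_right h1 h0

lemma integrableOn_comp_mul_left_mul_exp {φ : ℝ → ℝ}
    (hφ : ∀ t, 0 < t → IntegrableOn (fun x => φ x * Real.exp (-(t * x))) (Ioi 0))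
    {y c : ℝ} (hy : 0 < y) (hc : 0 < c) :
    IntegrableOn (fun x => φ (y * x) * Real.exp (-(c * x))) (Ioi 0) := by
  have h := (integrableOn_Ioi_comp_mul_left_iff
    (fun x => φ x * Real.exp (-(c / y * x))) 0 hy).2 (by simpa using hφ (c / y) (by positivity))
  refine h.congr_fun (fun x _ => ?_) measurableSet_Ioi
  simp only
  congr 3
  field_simp

lemma tendsto_integral_comp_mul_left_mul_exp {φ : ℝ → ℝ} {A c : ℝ} (hc : 0 < c)
    (hA : Tendsto (fun t => t * ∫ x in Ioi 0, φ x * Real.exp (-(t * x)))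
      (nhdsWithin 0 (Ioi 0)) (nhds A)) :
    Tendsto (fun y => ∫ x in Ioi 0, φ (y * x) * Real.exp (-(c * x))) atTop (nhds (A * c⁻¹)) := by
  have ht : Tendsto (fun y : ℝ => c / y) atTop (nhdsWithin 0 (Ioi 0)) := by
    refine tendsto_nhdsWithin_iff.2 ⟨tendsto_const_nhds.div_atTop tendsto_id, ?_⟩
    filter_upwards [eventually_gt_atTop 0] with y hy
    exact div_pos hc hy
  refine ((hA.comp ht).mul_const c⁻¹).congr' ?_
  filter_upwards [eventually_gt_atTop 0] with y hy
  have h := integral_comp_mul_left_Ioi (fun x => φ x * Real.exp (-(c / y * x))) 0 hy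
  rw [mul_zero, smul_eq_mul] at h
  have h' : (∫ x in Ioi 0, φ (y * x) * Real.exp (-(c * x))) =
      ∫ x in Ioi 0, φ (y * x) * Real.exp (-(c / y * (y * x))) := by
    congr 1
    ext x
    congr 3
    field_simp
  rw [h', h, Function.comp_apply]
  field_simp

lemma integral_Ioi_exp_neg_mul {c : ℝ} (hc : 0 < c) :
    ∫ x in Ioi (0 : ℝ), Real.exp (-(c * x)) = c⁻¹ := by
  have := integral_exp_mul_Ioi (a := -c) (by linarith) 0
  simpa [neg_mul] using this

/-- Karamata's theorem on averages, tested against polynomials. -/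
lemma tendsto_integral_comp_mul_left_polynomial {φ : ℝ → ℝ} {A : ℝ}
    (hφ : ∀ t, 0 < t → IntegrableOn (fun x => φ x * Real.exp (-(t * x))) (Ioi 0))
    (hA : Tendsto (fun t => t * ∫ x in Ioi 0, φ x * Real.exp (-(t * x)))
      (nhdsWithin 0 (Ioi 0)) (nhds A)) (p : Polynomial ℝ) :
    Tendsto (fun y => ∫ x in Ioi 0, φ (y * x) * (Real.exp (-x) * p.eval (Real.exp (-x)))) atTop
      (nhds (A * ∫ x in Ioi 0, Real.exp (-x) * p.eval (Real.exp (-x)))) := by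
  induction p using Polynomial.induction_on' with
  | add p q hp hq =>
    have hone : IntegrableOn (fun x : ℝ => (1 : ℝ) * Real.exp (-x)) (Ioi 0) := by
      simpa using integrableOn_exp_neg_Ioi 0
    have hadd : (∫ x in Ioi 0, Real.exp (-x) * (p + q).eval (Real.exp (-x))) =
        (∫ x in Ioi 0, Real.exp (-x) * p.eval (Real.exp (-x))) +
          ∫ x in Ioi 0, Real.exp (-x) * q.eval (Real.exp (-x)) := by
      rw [← integral_add]
      · simp only [Polynomial.eval_add, mul_add]
      · simpa using! integrableOn_mul_exp_mul_comp_exp p.continuous hone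
      · simpa using! integrableOn_mul_exp_mul_comp_exp q.continuous hone
    rw [hadd, mul_add]
    refine (hp.add hq).congr' ?_
    filter_upwards [eventually_gt_atTop 0] with y hy
    have hy1 : IntegrableOn (fun x => φ (y * x) * Real.exp (-x)) (Ioi 0) := by
      simpa using integrableOn_comp_mul_left_mul_exp hφ hy one_pos
    rw [← integral_add (integrableOn_mul_exp_mul_comp_exp p.continuous hy1)
      (integrableOn_mul_exp_mul_comp_exp q.continuous hy1)]
    simp only [Polynomial.eval_add, mul_add]
  | monomial n a =>
    have hc : (0 : ℝ) < n + 1 := by positivity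
    have he : ∀ x : ℝ, Real.exp (-x) * (Polynomial.monomial n a).eval (Real.exp (-x)) =
        a * Real.exp (-((n + 1 : ℝ) * x)) := by
      intro x
      rw [Polynomial.eval_monomial, ← Real.exp_nat_mul, mul_left_comm, ← Real.exp_add]
      ring_nf
    simp only [he, integral_const_mul, mul_left_comm _ a, integral_Ioi_exp_neg_mul hc]
    exact (tendsto_integral_comp_mul_left_mul_exp hc hA).const_mul a

/-- Karamata's theorem on averages, tested against continuous functions of `exp (-x)`. -/
lemma tendsto_integral_comp_mul_left_continuous {φ h : ℝ → ℝ} {A : ℝ} (hh : Continuous h)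
    (hpos : ∀ x, 0 < x → 0 ≤ φ x)
    (hφ : ∀ t, 0 < t → IntegrableOn (fun x => φ x * Real.exp (-(t * x))) (Ioi 0))
    (hA : Tendsto (fun t => t * ∫ x in Ioi 0, φ x * Real.exp (-(t * x)))
      (nhdsWithin 0 (Ioi 0)) (nhds A)) :
    Tendsto (fun y => ∫ x in Ioi 0, φ (y * x) * (Real.exp (-x) * h (Real.exp (-x)))) atTop
      (nhds (A * ∫ x in Ioi 0, Real.exp (-x) * h (Real.exp (-x)))) := by
  rw [Metric.tendsto_nhds]
  intro ε hε
  set δ := ε / (2 * |A| + 3) with hδ_def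
  have hden : 0 < 2 * |A| + 3 := by positivity
  have hδ : 0 < δ := div_pos hε hden
  have hδε : δ * (2 * |A| + 3) = ε := div_mul_cancel₀ _ hden.ne'
  obtain ⟨p, hp⟩ := exists_polynomial_near_of_continuousOn 0 1 h hh.continuousOn δ hδ
  have hp' : ∀ u ∈ Icc (0 : ℝ) 1, |h u - p.eval u| ≤ δ := fun u hu => by
    rw [abs_sub_comm]
    exact (hp u hu).le
  have hone : IntegrableOn (fun x : ℝ => (1 : ℝ) * Real.exp (-x)) (Ioi 0) := by
    simpa using integrableOn_exp_neg_Ioi 0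
  have hJ := abs_integral_mul_exp_mul_comp_exp_sub_le (φ := fun _ => 1) hh p.continuous
    (fun _ _ => zero_le_one) hone hp'
  simp only [one_mul, integral_exp_neg_Ioi_zero, mul_one] at hJ
  have hlim := tendsto_integral_comp_mul_left_mul_exp one_pos hA
  simp only [one_mul, inv_one, mul_one] at hlim
  have hbd : ∀ᶠ y in atTop, ∫ x in Ioi 0, φ (y * x) * Real.exp (-x) < |A| + 1 :=
    hlim.eventually_lt_const (by linarith [le_abs_self A])
  filter_upwards [hbd, eventually_gt_atTop 0,
    Metric.tendsto_nhds.1 (tendsto_integral_comp_mul_left_polynomial hφ hA p) δ hδ] with y hb hy hy'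
  have hy1 : IntegrableOn (fun x => φ (y * x) * Real.exp (-x)) (Ioi 0) := by
    simpa using integrableOn_comp_mul_left_mul_exp hφ hy one_pos
  have hI := abs_integral_mul_exp_mul_comp_exp_sub_le hh p.continuous
    (fun x hx => hpos _ (mul_pos hy hx)) hy1 hp'
  rw [Real.dist_eq] at hy' ⊢
  have h1 : δ * ∫ x in Ioi 0, φ (y * x) * Real.exp (-x) ≤ δ * (|A| + 1) :=
    mul_le_mul_of_nonneg_left hb.le hδ.le
  set I₁ := ∫ x in Ioi 0, φ (y * x) * (Real.exp (-x) * h (Real.exp (-x)))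
  set I₂ := ∫ x in Ioi 0, φ (y * x) * (Real.exp (-x) * p.eval (Real.exp (-x)))
  set J₁ := ∫ x in Ioi 0, Real.exp (-x) * h (Real.exp (-x))
  set J₂ := ∫ x in Ioi 0, Real.exp (-x) * p.eval (Real.exp (-x))
  have h2 : |A * J₂ - A * J₁| ≤ |A| * δ := by
    rw [← mul_sub, abs_mul, abs_sub_comm]
    exact mul_le_mul_of_nonneg_left hJ (abs_nonneg A)
  have h3 := abs_sub_le I₁ I₂ (A * J₁)
  have h4 := abs_sub_le I₂ (A * J₂) (A * J₁)
  nlinarith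

/-- Averages over dilates of a weight supported in a prescribed interval. -/
lemma exists_weight_tendsto_integral {φ : ℝ → ℝ} {A a b : ℝ} (ha : 0 < a) (hab : a < b)
    (hpos : ∀ x, 0 < x → 0 ≤ φ x)
    (hφ : ∀ t, 0 < t → IntegrableOn (fun x => φ x * Real.exp (-(t * x))) (Ioi 0))
    (hA : Tendsto (fun t => t * ∫ x in Ioi 0, φ x * Real.exp (-(t * x)))
      (nhdsWithin 0 (Ioi 0)) (nhds A)) :
    ∃ w : ℝ → ℝ, (∀ x, 0 ≤ w x) ∧ (∀ x, w x ≠ 0 → x ∈ Ioo a b) ∧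
      IntegrableOn w (Ioi 0) ∧ 0 < ∫ x in Ioi 0, w x ∧
      (∀ y, 0 < y → IntegrableOn (fun x => φ (y * x) * w x) (Ioi 0)) ∧
      Tendsto (fun y => ∫ x in Ioi 0, φ (y * x) * w x) atTop (nhds (A * ∫ x in Ioi 0, w x)) := by
  set h : ℝ → ℝ := fun u => max 0 ((u - Real.exp (-b)) * (Real.exp (-a) - u)) with h_def
  have hh : Continuous h := by fun_prop
  have h0 : ∀ u, 0 ≤ h u := fun u => le_max_left _ _
  have hw0 : ∀ x, 0 ≤ Real.exp (-x) * h (Real.exp (-x)) :=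
    fun x => mul_nonneg (Real.exp_pos _).le (h0 _)
  have hint : IntegrableOn (fun x => Real.exp (-x) * h (Real.exp (-x))) (Ioi 0) := by
    simpa using! integrableOn_mul_exp_mul_comp_exp (φ := fun _ => 1) hh
      (by simpa using integrableOn_exp_neg_Ioi 0)
  refine ⟨fun x => Real.exp (-x) * h (Real.exp (-x)), hw0, ?_, hint, ?_, ?_, ?_⟩
  · intro x hx
    by_contra hx'
    refine hx ?_
    suffices h (Real.exp (-x)) = 0 by simp [this]
    refine max_eq_left ?_
    rw [mem_Ioo, not_and_or, not_lt, not_lt] at hx'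
    rcases hx' with hx' | hx'
    · refine mul_nonpos_of_nonneg_of_nonpos (sub_nonneg.2 ?_) (sub_nonpos.2 ?_) <;>
        rw [Real.exp_le_exp] <;> linarith
    · refine mul_nonpos_of_nonpos_of_nonneg (sub_nonpos.2 ?_) (sub_nonneg.2 ?_) <;>
        rw [Real.exp_le_exp] <;> linarith
  · rw [setIntegral_pos_iff_support_of_nonneg_ae (Eventually.of_forall hw0) hint]
    refine lt_of_lt_of_le ?_ (measure_mono (s := Ioo a b) ?_)
    · simpa using hab
    · intro x hx
      refine ⟨?_, ha.trans hx.1⟩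
      refine (mul_pos (Real.exp_pos _) (lt_max_of_lt_right (mul_pos ?_ ?_))).ne' <;>
        rw [sub_pos, Real.exp_lt_exp]
      · linarith [hx.2]
      · linarith [hx.1]
  · intro y hy
    exact integrableOn_mul_exp_mul_comp_exp hh
      (by simpa using integrableOn_comp_mul_left_mul_exp hφ hy one_pos)
  · exact tendsto_integral_comp_mul_left_continuous hh hpos hφ hA

lemma SlowlyDecreasing.exists_eventually {φ : ℝ → ℝ} (h : SlowlyDecreasing φ) {ε : ℝ}
    (hε : 0 < ε) :
    ∃ b, 1 < b ∧ ∀ lam ∈ Ioo 1 b, ∀ᶠ x in atTop, -ε < φ (lam * x) - φ x := by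
  have h1 : ((-ε : ℝ) : EReal) < 0 := by exact_mod_cast neg_lt_zero.2 hε
  have h2 := eventually_lt_of_lt_liminf (lt_of_lt_of_le h1 h)
  obtain ⟨b, hb, hsub⟩ := mem_nhdsGT_iff_exists_Ioo_subset.1 h2
  refine ⟨b, hb, fun lam hlam => ?_⟩
  have h3 : ((-ε : ℝ) : EReal) <
      liminf (fun x : ℝ => ((φ (lam * x) - φ x : ℝ) : EReal)) atTop := hsub hlam
  filter_upwards [eventually_lt_of_lt_liminf h3] with x hx
  exact_mod_cast hx

lemma aestronglyMeasurable_comp_mul_left {φ : ℝ → ℝ}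
    (hφ : ∀ t, 0 < t → IntegrableOn (fun x => φ x * Real.exp (-(t * x))) (Ioi 0))
    {y : ℝ} (hy : 0 < y) :
    AEStronglyMeasurable (fun x => φ (y * x)) (volume.restrict (Ioi 0)) := by
  have h := (integrableOn_comp_mul_left_mul_exp hφ hy one_pos).aestronglyMeasurable.mul
    (Continuous.aestronglyMeasurable (by fun_prop : Continuous fun x : ℝ => Real.exp x))
  refine h.congr (Eventually.of_forall fun x => ?_)
  simp [mul_assoc, ← Real.exp_add]

/-- Slow decrease and convergent averages give an upper bound. -/
lemma SlowlyDecreasing.eventually_lt {φ : ℝ → ℝ} {A ε : ℝ} (hsd : SlowlyDecreasing φ)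
    (hpos : ∀ x, 0 < x → 0 ≤ φ x)
    (hφ : ∀ t, 0 < t → IntegrableOn (fun x => φ x * Real.exp (-(t * x))) (Ioi 0))
    (hA : Tendsto (fun t => t * ∫ x in Ioi 0, φ x * Real.exp (-(t * x)))
      (nhdsWithin 0 (Ioi 0)) (nhds A)) (hε : 0 < ε) :
    ∀ᶠ x in atTop, φ x < A + 2 * ε := by
  by_contra hcon
  have hne : NeBot (atTop ⊓ principal {x | ¬ φ x < A + 2 * ε}) := frequently_iff_neBot.1 (not_eventually.1 hcon)
  obtain ⟨b, hb, hdec⟩ := hsd.exists_eventually hε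
  obtain ⟨w, hw0, hwsupp, hwint, hwpos, hwφ, hwlim⟩ :=
    exists_weight_tendsto_integral one_pos hb hpos hφ hA
  have hle : atTop ⊓ principal {x | ¬ φ x < A + 2 * ε} ≤ atTop := inf_le_left
  have hbad : ∀ᶠ y in atTop ⊓ principal {x | ¬ φ x < A + 2 * ε}, A + 2 * ε ≤ φ y := by
    filter_upwards [mem_inf_of_right (mem_principal_self _)] with y hy
    exact not_lt.1 hy
  have hgt : ∀ᶠ y in atTop ⊓ principal {x | ¬ φ x < A + 2 * ε}, 0 < y := hle (eventually_gt_atTop 0)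
  have hmeas : ∀ y, 0 < y → AEStronglyMeasurable (fun x => min (φ (y * x)) (A + ε) * w x)
      (volume.restrict (Ioi 0)) := fun y hy =>
    ((aestronglyMeasurable_comp_mul_left hφ hy).inf aestronglyMeasurable_const).mul
      hwint.aestronglyMeasurable
  have hbound : ∀ y, 0 < y → ∀ᵐ x ∂(volume.restrict (Ioi (0 : ℝ))),
      ‖min (φ (y * x)) (A + ε) * w x‖ ≤ |A + ε| * w x := by
    intro y hy
    filter_upwards [ae_restrict_mem measurableSet_Ioi] with x hx
    rw [norm_mul, Real.norm_eq_abs, Real.norm_of_nonneg (hw0 x)]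
    refine mul_le_mul_of_nonneg_right (abs_le.2 ⟨?_, ?_⟩) (hw0 x)
    · exact le_min ((neg_nonpos.2 (abs_nonneg _)).trans (hpos _ (mul_pos hy hx))) (neg_abs_le _)
    · exact (min_le_right _ _).trans (le_abs_self _)
  have hdom := tendsto_integral_filter_of_dominated_convergence
    (l := atTop ⊓ principal {x | ¬ φ x < A + 2 * ε})
    (F := fun y x => min (φ (y * x)) (A + ε) * w x) (f := fun x => (A + ε) * w x)
    (μ := volume.restrict (Ioi 0)) (fun x => |A + ε| * w x)
    (hgt.mono hmeas) (hgt.mono hbound) (hwint.const_mul _)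
    (Eventually.of_forall fun x => by
      refine tendsto_const_nhds.congr' ?_
      by_cases hx : w x = 0
      · simp [hx]
      · filter_upwards [hbad, hle (hdec x (hwsupp x hx))] with y hy hy'
        rw [mul_comm x y] at hy'
        rw [min_eq_right (by linarith)])
  have hcmp := le_of_tendsto_of_tendsto hdom (hwlim.mono_left hle) (by
    filter_upwards [hgt] with y hy
    refine integral_mono_ae ((hwint.const_mul _).mono' (hmeas y hy) (hbound y hy)) (hwφ y hy)
      (Eventually.of_forall fun x => ?_)
    exact mul_le_mul_of_nonneg_right (min_le_left _ _) (hw0 x))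
  rw [integral_const_mul] at hcmp
  nlinarith [mul_pos hε hwpos]

/-- Slow decrease and convergent averages give a lower bound. -/
lemma SlowlyDecreasing.eventually_gt {φ : ℝ → ℝ} {A ε : ℝ} (hsd : SlowlyDecreasing φ)
    (hpos : ∀ x, 0 < x → 0 ≤ φ x)
    (hφ : ∀ t, 0 < t → IntegrableOn (fun x => φ x * Real.exp (-(t * x))) (Ioi 0))
    (hA : Tendsto (fun t => t * ∫ x in Ioi 0, φ x * Real.exp (-(t * x)))
      (nhdsWithin 0 (Ioi 0)) (nhds A)) (hε : 0 < ε) :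
    ∀ᶠ x in atTop, A - 2 * ε < φ x := by
  by_contra hcon
  have hne : NeBot (atTop ⊓ principal {x | ¬ A - 2 * ε < φ x}) := frequently_iff_neBot.1 (not_eventually.1 hcon)
  obtain ⟨b, hb, hdec⟩ := hsd.exists_eventually hε
  have hb0 : 0 < b := one_pos.trans hb
  obtain ⟨w, hw0, hwsupp, hwint, hwpos, hwφ, hwlim⟩ :=
    exists_weight_tendsto_integral (inv_pos.2 hb0) (inv_lt_one_of_one_lt₀ hb) hpos hφ hA
  obtain ⟨X, hX⟩ := eventually_atTop.1 (hsd.eventually_lt hpos hφ hA one_pos)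
  have hle : atTop ⊓ principal {x | ¬ A - 2 * ε < φ x} ≤ atTop := inf_le_left
  have hbad : ∀ᶠ y in atTop ⊓ principal {x | ¬ A - 2 * ε < φ x}, φ y ≤ A - 2 * ε := by
    filter_upwards [mem_inf_of_right (mem_principal_self _)] with y hy
    exact not_lt.1 hy
  have hgt : ∀ᶠ y in atTop ⊓ principal {x | ¬ A - 2 * ε < φ x}, 0 < y ∧ X * b ≤ y :=
    hle ((eventually_gt_atTop 0).and (eventually_ge_atTop _))
  have hmeas : ∀ y, 0 < y → AEStronglyMeasurable (fun x => max (φ (y * x)) (A - ε) * w x)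
      (volume.restrict (Ioi 0)) := fun y hy =>
    ((aestronglyMeasurable_comp_mul_left hφ hy).sup aestronglyMeasurable_const).mul
      hwint.aestronglyMeasurable
  have hbound : ∀ y, 0 < y ∧ X * b ≤ y → ∀ᵐ x ∂(volume.restrict (Ioi (0 : ℝ))),
      ‖max (φ (y * x)) (A - ε) * w x‖ ≤ (|A| + 2 + ε) * w x := by
    rintro y ⟨hy, hyX⟩
    filter_upwards [ae_restrict_mem measurableSet_Ioi] with x hx
    by_cases hwx : w x = 0
    · simp [hwx]
    have hxb : X ≤ y * x := by
      have h1 : X ≤ y * b⁻¹ := by rwa [← div_eq_mul_inv, le_div_iff₀ hb0]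
      exact h1.trans (mul_le_mul_of_nonneg_left (hwsupp x hwx).1.le hy.le)
    have h1 := hX _ hxb
    have h2 := hpos _ (mul_pos hy hx)
    have h3 := le_abs_self A
    have h4 := abs_nonneg A
    rw [norm_mul, Real.norm_eq_abs, Real.norm_of_nonneg (hw0 x)]
    refine mul_le_mul_of_nonneg_right (abs_le.2 ⟨?_, max_le ?_ ?_⟩) (hw0 x)
    · exact le_max_of_le_left (by linarith)
    · linarith
    · linarith
  have hdom := tendsto_integral_filter_of_dominated_convergence
    (l := atTop ⊓ principal {x | ¬ A - 2 * ε < φ x})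
    (F := fun y x => max (φ (y * x)) (A - ε) * w x) (f := fun x => (A - ε) * w x)
    (μ := volume.restrict (Ioi 0)) (fun x => (|A| + 2 + ε) * w x)
    (hgt.mono fun y hy => hmeas y hy.1) (hgt.mono hbound) (hwint.const_mul _)
    (Eventually.of_forall fun x => by
      refine tendsto_const_nhds.congr' ?_
      by_cases hx : w x = 0
      · simp [hx]
      · have hxs := hwsupp x hx
        have hx0 : 0 < x := (inv_pos.2 hb0).trans hxs.1
        have hxinv : x⁻¹ ∈ Ioo 1 b :=
          ⟨(one_lt_inv₀ hx0).2 hxs.2, (inv_lt_comm₀ hx0 hb0).2 hxs.1⟩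
        filter_upwards [hbad,
          hle ((tendsto_id.atTop_mul_const hx0).eventually (hdec _ hxinv))] with y hy hy'
        rw [id, mul_comm y x, inv_mul_cancel_left₀ hx0.ne', mul_comm x y] at hy'
        rw [max_eq_right (by linarith)])
  have hcmp := le_of_tendsto_of_tendsto (hwlim.mono_left hle) hdom (by
    filter_upwards [hgt] with y hy
    refine integral_mono_ae (hwφ y hy.1)
      ((hwint.const_mul _).mono' (hmeas y hy.1) (hbound y hy))
      (Eventually.of_forall fun x => ?_)
    exact mul_le_mul_of_nonneg_right (le_max_left _ _) (hw0 x))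
  rw [integral_const_mul] at hcmp
  nlinarith [mul_pos hε hwpos]

/-- The Hardy–Littlewood–Karamata theorem for nonnegative slowly decreasing functions. -/
theorem SlowlyDecreasing.tendsto_of_laplace {φ : ℝ → ℝ} {A : ℝ} (hsd : SlowlyDecreasing φ)
    (hpos : ∀ x, 0 < x → 0 ≤ φ x)
    (hφ : ∀ t, 0 < t → IntegrableOn (fun x => φ x * Real.exp (-(t * x))) (Ioi 0))
    (hA : Tendsto (fun t => t * ∫ x in Ioi 0, φ x * Real.exp (-(t * x)))
      (nhdsWithin 0 (Ioi 0)) (nhds A)) :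
    Tendsto φ atTop (nhds A) := by
  rw [Metric.tendsto_nhds]
  intro ε hε
  filter_upwards [hsd.eventually_lt hpos hφ hA (half_pos hε),
    hsd.eventually_gt hpos hφ hA (half_pos hε)] with x h1 h2
  rw [Real.dist_eq, abs_lt]
  constructor <;> linarith

/-- For a nonnegative function, convergence of the improper Laplace integral is integrability. -/
lemma integrableOn_mul_exp_of_tendsto {α : ℝ → ℝ} {s L : ℝ} (hpos : ∀ x, 0 ≤ x → 0 ≤ α x)
    (hloc : LocallyIntegrableOn α (Ici 0))
    (h : Tendsto (fun X : ℝ => ∫ x in (0 : ℝ)..X, α x * Real.exp (-(s * x))) atTop (nhds L)) :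
    IntegrableOn (fun x => α x * Real.exp (-(s * x))) (Ioi 0) := by
  refine integrableOn_Ioi_of_intervalIntegral_norm_tendsto (ι := ℝ) (l := atTop) (b := id) L 0
    (fun X => ?_) tendsto_id (h.congr' ?_)
  · have h1 : IntegrableOn α (Icc 0 X) :=
      hloc.integrableOn_compact_subset Icc_subset_Ici_self isCompact_Icc
    exact (h1.mul_continuousOn (by fun_prop) isCompact_Icc).mono_set Ioc_subset_Icc_self
  · filter_upwards [eventually_ge_atTop 0] with X hX
    refine intervalIntegral.integral_congr fun x hx => ?_
    rw [uIcc_of_le hX] at hx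
    exact (Real.norm_of_nonneg (mul_nonneg (hpos x hx.1) (Real.exp_pos _).le)).symm

/-- Generalized Wiener–Ikehara theorem on the real axis: if `α ≥ 0` is locally
integrable, its Laplace transform `g(s) = ∫₀^∞ α(x) e^{-sx} dx` (an improper
integral) exists for all real `s > μ` with `μ ≥ 0`,
`g(s) − A/(s − μ) → ℓ` as `s → μ⁺`, and `φ(x) = e^{-μx} α(x)` is slowly
decreasing, then `e^{-μx} α(x) → A` as `x → ∞`. -/
theorem wiener_ikehara_real_axis
    (α : ℝ → ℝ) (g : ℝ → ℝ) (μ A ℓ : ℝ)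
    (hμ : 0 ≤ μ)
    (hpos : ∀ x, 0 ≤ x → 0 ≤ α x)
    (hloc : LocallyIntegrableOn α (Ici 0))
    (hg : ∀ s : ℝ, μ < s →
      Tendsto (fun X : ℝ => ∫ x in (0 : ℝ)..X, α x * Real.exp (-(s * x)))
        atTop (nhds (g s)))
    (hℓ : Tendsto (fun s : ℝ => g s - A / (s - μ)) (nhdsWithin μ (Ioi μ)) (nhds ℓ))
    (hsd : SlowlyDecreasing (fun x : ℝ => Real.exp (-(μ * x)) * α x)) :
    Tendsto (fun x : ℝ => Real.exp (-(μ * x)) * α x) atTop (nhds A) := by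
  have hint : ∀ s, μ < s → IntegrableOn (fun x => α x * Real.exp (-(s * x))) (Ioi 0) :=
    fun s hs => integrableOn_mul_exp_of_tendsto hpos hloc (hg s hs)
  have hgs : ∀ s, μ < s → g s = ∫ x in Ioi 0, α x * Real.exp (-(s * x)) := fun s hs =>
    tendsto_nhds_unique (hg s hs)
      (intervalIntegral_tendsto_integral_Ioi 0 (hint s hs) tendsto_id)
  have he : ∀ t x : ℝ, Real.exp (-(μ * x)) * α x * Real.exp (-(t * x)) =
      α x * Real.exp (-((μ + t) * x)) := by
    intro t x
    rw [mul_comm (Real.exp _), mul_assoc, ← Real.exp_add]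
    ring_nf
  refine hsd.tendsto_of_laplace (fun x hx => mul_nonneg (Real.exp_pos _).le (hpos x hx.le)) ?_ ?_
  · intro t ht
    simpa only [he] using hint (μ + t) (by linarith)
  · have hid : Tendsto (fun t : ℝ => t) (nhdsWithin 0 (Ioi 0)) (nhds 0) := nhdsWithin_le_nhds
    have hshift : Tendsto (fun t : ℝ => μ + t) (nhdsWithin 0 (Ioi 0)) (nhdsWithin μ (Ioi μ)) := by
      refine tendsto_nhdsWithin_iff.2 ⟨by simpa using hid.const_add μ, ?_⟩
      filter_upwards [self_mem_nhdsWithin] with t ht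
      simpa using ht
    have hlim := (hid.mul (hℓ.comp hshift)).add_const A
    rw [zero_mul, zero_add] at hlim
    refine hlim.congr' ?_
    filter_upwards [self_mem_nhdsWithin] with t ht
    have ht0 : (0 : ℝ) < t := ht
    simp only [he, Function.comp_apply]
    rw [← hgs _ (by linarith), add_sub_cancel_left]
    field_simp
    ring
end

section
/- The function x ↦ ψ(x)/x on (0,∞), where ψ is the Chebyshev prime counting function, is slowly decreasing at infinity: lim_{λ→1⁺} liminf_{x→∞} ( ψ(λx)/(λx) − ψ(x)/x ) ≥ 0. -/
open Filter Set ArithmeticFunction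

/-- The Chebyshev prime counting function `ψ(x) = ∑_{n ≤ x} Λ(n)`, where `Λ`
is the von Mangoldt function. -/
noncomputable def chebyshevPsi (x : ℝ) : ℝ := ∑ n ∈ Finset.Iic ⌊x⌋₊, Λ n

theorem chebyshevPsi_eq_psi (x : ℝ) : chebyshevPsi x = Chebyshev.psi x := by
  rw [chebyshevPsi, Chebyshev.psi_eq_sum_Icc]
  rfl

theorem exists_chebyshevPsi_le_mul : ∃ C : ℝ, ∀ x : ℝ, 0 ≤ x → chebyshevPsi x ≤ C * x :=
  ⟨_, fun x hx => (chebyshevPsi_eq_psi x).trans_le (Chebyshev.psi_le_const_mul_self hx)⟩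

theorem chebyshevPsi_mono : Monotone chebyshevPsi := fun x y hxy => by
  simpa only [chebyshevPsi_eq_psi] using Chebyshev.psi_mono hxy

theorem mul_inv_sub_one_le_chebyshevPsi_div_sub {C lam x : ℝ}
    (hC : chebyshevPsi x ≤ C * x) (hlam : 1 < lam) (hx : 0 < x) :
    C * (lam⁻¹ - 1) ≤ chebyshevPsi (lam * x) / (lam * x) - chebyshevPsi x / x := by
  have hmono : chebyshevPsi x ≤ chebyshevPsi (lam * x) :=
    chebyshevPsi_mono (le_mul_of_one_le_left hx.le hlam.le)
  have hinv : lam⁻¹ - 1 ≤ 0 := sub_nonpos.2 (inv_le_one_of_one_le₀ hlam.le)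
  calc C * (lam⁻¹ - 1) ≤ chebyshevPsi x / x * (lam⁻¹ - 1) :=
        mul_le_mul_of_nonpos_right ((div_le_iff₀ hx).2 hC) hinv
    _ = chebyshevPsi x / (lam * x) - chebyshevPsi x / x := by
        field_simp
    _ ≤ chebyshevPsi (lam * x) / (lam * x) - chebyshevPsi x / x := by
        gcongr

/-- The function `x ↦ ψ(x)/x` is slowly decreasing at infinity. -/
theorem chebyshevPsi_div_slowlyDecreasing :
    SlowlyDecreasing (fun x : ℝ => chebyshevPsi x / x) := by
  obtain ⟨C, hC⟩ := exists_chebyshevPsi_le_mul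
  have hlim : Tendsto (fun lam : ℝ => ((C * (lam⁻¹ - 1) : ℝ) : EReal))
      (nhdsWithin 1 (Ioi 1)) (nhds 0) := by
    have h : ContinuousAt (fun lam : ℝ => C * (lam⁻¹ - 1)) 1 :=
      continuousAt_const.mul ((continuousAt_inv₀ one_ne_zero).sub continuousAt_const)
    have h' := (continuous_coe_real_ereal.continuousAt.comp h).tendsto.mono_left
      (nhdsWithin_le_nhds (s := Ioi 1))
    simpa [Function.comp_def] using h'
  rw [SlowlyDecreasing, ← hlim.liminf_eq]
  refine liminf_le_liminf ?_
  filter_upwards [self_mem_nhdsWithin] with lam hlam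
  refine le_liminf_of_le (by isBoundedDefault) ?_
  filter_upwards [eventually_gt_atTop 0] with x hx
  exact EReal.coe_le_coe_iff.2
    (mul_inv_sub_one_le_chebyshevPsi_div_sub (hC x hx.le) hlam hx)
end

section
/- As s → 1⁺ along the reals, the logarithmic derivative of the Riemann zeta function satisfies ζ'(s)/ζ(s) = −1/(s − 1) + γ + O(s − 1), where γ is the Euler–Mascheroni constant; that is, the function s ↦ ζ'(s)/ζ(s) + 1/(s − 1) − γ is O(s − 1) as s → 1⁺. -/
open Filter Set Asymptotics

/-- The Riemann zeta function of a real variable, `ζ(s) = ∑_{n=1}^∞ 1/n^s`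
(the `n = 0` term vanishes since `(0 : ℝ)^s = 0` for `s ≠ 0`). -/
noncomputable def realZeta (s : ℝ) : ℝ := ∑' n : ℕ, 1 / (n : ℝ) ^ s

theorem ofReal_realZeta {s : ℝ} (hs : 1 < s) : (realZeta s : ℂ) = riemannZeta s := by
  rw [zeta_eq_tsum_one_div_nat_cpow (by simpa using hs), realZeta, Complex.ofReal_tsum]
  refine tsum_congr fun n => ?_
  rw [Complex.ofReal_div, Complex.ofReal_cpow n.cast_nonneg, Complex.ofReal_one,
    Complex.ofReal_natCast]

theorem ofReal_deriv_realZeta {s : ℝ} (hs : 1 < s) :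
    ((deriv realZeta s : ℝ) : ℂ) = deriv riemannZeta s := by
  have hζ : HasDerivAt riemannZeta (deriv riemannZeta s) (s : ℂ) :=
    (differentiableAt_riemannZeta (by exact_mod_cast hs.ne')).hasDerivAt
  have heq : ∀ᶠ x : ℝ in nhds s, (realZeta x : ℂ) = riemannZeta x :=
    (eventually_gt_nhds hs).mono fun _ hx => ofReal_realZeta hx
  have hre : HasDerivAt realZeta (deriv riemannZeta s).re s :=
    hζ.real_of_complex.congr_of_eventuallyEq <| heq.mono fun x hx => by
      simp [← hx]
  exact hre.differentiableAt.hasDerivAt.ofReal_comp.unique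
    (hζ.comp_ofReal.congr_of_eventuallyEq heq)

/-- As `s → 1⁺` along the reals,
`ζ'(s)/ζ(s) = −1/(s − 1) + γ + O(s − 1)`, where `γ` is the Euler–Mascheroni
constant. -/
theorem realZeta_logDeriv_asymptotic :
    (fun s : ℝ => deriv realZeta s / realZeta s + 1 / (s - 1)
        - Real.eulerMascheroniConstant)
      =O[nhdsWithin 1 (Ioi 1)] (fun s : ℝ => s - 1) := by
  have hlim : Tendsto ((↑) : ℝ → ℂ) (nhdsWithin 1 (Ioi 1)) (nhdsWithin 1 {1}ᶜ) := by
    refine tendsto_nhdsWithin_iff.2 ⟨?_, ?_⟩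
    · exact (Complex.continuous_ofReal.tendsto' 1 1 Complex.ofReal_one).mono_left
        nhdsWithin_le_nhds
    · filter_upwards [self_mem_nhdsWithin] with s hs
      exact Complex.ofReal_ne_one.2 (mem_Ioi.1 hs).ne'
  refine IsBigO.of_norm_norm <|
    (log_deriv_riemannZeta_add_inv_sub_sub_isBigO.comp_tendsto hlim).norm_norm.congr' ?_ ?_
  · filter_upwards [self_mem_nhdsWithin] with s hs
    rw [Function.comp_apply, ← ofReal_realZeta hs, ← ofReal_deriv_realZeta hs, ← Complex.norm_real]
    simp
  · filter_upwards with s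
    rw [Function.comp_apply, ← Complex.norm_real]
    simp
end
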